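/- Let y ∈ [0, 2/3] and suppose the level set L(y) is finite. Then its cardinality is given by |L(y)| = 2 · |{x₀ ∈ B : y ∈ J^t(x₀)}|, i.e. twice the number of balanced dyadic rationals x₀ (of order m = m(x₀)) with T(x₀) ≤ y ≤ T(x₀) + (1/2)·4^{-m}. -/

import Mathlib

open Set MeasureTheory ENNReal

/-- `phi x` is the distance from `x` to the nearest integer. -/
noncomputable def phi (x : ℝ) : ℝ := |x - (round x : ℤ)|

/-- The Takagi function. -/
noncomputable def T (x : ℝ) : ℝ := ∑' n : ℕ, phi (2 ^ n * x) / 2 ^ n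

/-- The `n`-th binary digit of `x` (terminating expansion for dyadic rationals). -/
noncomputable def eps (n : ℕ) (x : ℝ) : ℤ := ⌊2 ^ n * x⌋ - 2 * ⌊2 ^ (n - 1) * x⌋

/-- `D k x = ∑_{j=1}^k (-1)^{ε_j(x)}`, the excess of 0 digits over 1 digits. -/
noncomputable def D (k : ℕ) (x : ℝ) : ℤ := ∑ j ∈ Finset.Icc 1 k, (1 - 2 * eps j x)

/-- The level set of the Takagi function at level `y`. -/
def L (y : ℝ) : Set ℝ := {x | x ∈ Set.Icc (0:ℝ) 1 ∧ T x = y}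

/-- `x` is a balanced dyadic rational of order `m`. -/
def BalancedOfOrder (x : ℝ) (m : ℕ) : Prop :=
  x ∈ Set.Ico (0:ℝ) 1 ∧ (∃ k : ℤ, x = (k : ℝ) / 2 ^ (2 * m)) ∧ D (2 * m) x = 0

/-- The generation of a balanced dyadic rational of order `m`:
the number of indices `1 ≤ j ≤ 2m` with `D j x = 0`. -/
noncomputable def generation (x : ℝ) (m : ℕ) : ℕ :=
  ((Finset.Icc 1 (2 * m)).filter (fun j => D j x = 0)).card

/-- A balanced dyadic rational of order `m` is leading if `D j x ≥ 0` for all `1 ≤ j ≤ 2m`. -/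
def Leading (x : ℝ) (m : ℕ) : Prop := ∀ j ∈ Finset.Icc 1 (2 * m), 0 ≤ D j x

/-- The equivalence relation whose classes are the local level sets. -/
def locSetoid : Setoid ℝ where
  r x x' := ∀ n : ℕ, 1 ≤ n → |D n x| = |D n x'|
  iseqv := ⟨fun _ _ _ => rfl, fun h n hn => (h n hn).symm,
    fun h g n hn => (h n hn).trans (g n hn)⟩

/-- The set of local level sets contained in `L y`: the image of `L y ∩ [0,1)`
under the quotient map of `locSetoid`. -/
def locClasses (y : ℝ) : Set (Quotient locSetoid) :=
  Quotient.mk locSetoid '' (L y ∩ Set.Ico (0:ℝ) 1)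

/-! ### The distance to the nearest integer -/

theorem phi_nonneg (x : ℝ) : 0 ≤ phi x := abs_nonneg _

theorem phi_le_abs_sub (x : ℝ) (z : ℤ) : phi x ≤ |x - z| := round_le x z

theorem phi_le_half (x : ℝ) : phi x ≤ 1 / 2 := abs_sub_round x

theorem phi_add_int (x : ℝ) (z : ℤ) : phi (x + z) = phi x := by
  unfold phi
  rw [round_add_intCast]
  push_cast
  congr 1
  ring

theorem phi_neg (x : ℝ) : phi (-x) = phi x := by
  apply le_antisymm
  · refine (phi_le_abs_sub (-x) (-round x)).trans (le_of_eq ?_)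
    rw [phi, ← abs_neg]
    push_cast
    congr 1
    ring
  · refine (phi_le_abs_sub x (-round (-x))).trans (le_of_eq ?_)
    rw [phi, ← abs_neg]
    push_cast
    congr 1
    ring

theorem phi_of_le_half {x : ℝ} (h0 : 0 ≤ x) (h1 : x ≤ 1 / 2) : phi x = x := by
  have hf : Int.fract x = x := Int.fract_eq_self.2 ⟨h0, by linarith⟩
  rw [phi, abs_sub_round_eq_min, hf, min_eq_left (by linarith)]

theorem phi_of_half_le {x : ℝ} (h0 : 1 / 2 ≤ x) (h1 : x ≤ 1) : phi x = 1 - x := by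
  rw [← phi_of_le_half (x := 1 - x) (by linarith) (by linarith), ← phi_neg,
    ← phi_add_int (-x) 1]
  congr 1
  push_cast
  ring

theorem continuous_phi : Continuous phi := by
  have h : ∀ x y, phi x ≤ phi y + |x - y| := fun x y => by
    have h1 := phi_le_abs_sub x (round y)
    have h2 := abs_sub_le x y (round y)
    unfold phi at *
    linarith
  refine LipschitzWith.continuous (K := 1) (LipschitzWith.of_dist_le_mul fun x y => ?_)
  rw [Real.dist_eq, Real.dist_eq, NNReal.coe_one, one_mul, abs_le]
  have h1 := h x y
  have h2 := h y x
  rw [abs_sub_comm y x] at h2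
  constructor <;> linarith

/-! ### Basic properties of the Takagi function -/

theorem T_term_le (x : ℝ) (n : ℕ) : phi (2 ^ n * x) / 2 ^ n ≤ 1 / 2 / 2 ^ n :=
  div_le_div_of_nonneg_right (phi_le_half _) (by positivity)

theorem summable_T (x : ℝ) : Summable fun n : ℕ => phi (2 ^ n * x) / 2 ^ n :=
  Summable.of_nonneg_of_le (fun n => div_nonneg (phi_nonneg _) (by positivity)) (T_term_le x)
    (summable_geometric_two' (1 / 2 * 2) |>.congr fun n => by ring)

theorem T_nonneg (x : ℝ) : 0 ≤ T x :=
  tsum_nonneg fun n => div_nonneg (phi_nonneg _) (by positivity)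

theorem continuous_T : Continuous T := by
  refine continuous_tsum (u := fun n : ℕ => (1:ℝ) / 2 / 2 ^ n)
    (fun n => (continuous_phi.comp (by fun_prop)).div_const _)
    (summable_geometric_two' (1 / 2 * 2) |>.congr fun n => by ring) fun n x => ?_
  rw [Real.norm_of_nonneg (div_nonneg (phi_nonneg _) (by positivity))]
  exact T_term_le x n

theorem T_le_one (x : ℝ) : T x ≤ 1 := by
  rw [← tsum_geometric_two' 1]
  exact (summable_T x).tsum_le_tsum (fun n => T_term_le x n) (summable_geometric_two' 1)

theorem T_eq_phi_add (x : ℝ) : T x = phi x + T (2 * x) / 2 := by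
  unfold T
  rw [(summable_T x).tsum_eq_zero_add, ← tsum_div_const]
  congr 1
  · simp
  · refine tsum_congr fun n => ?_
    rw [div_div, ← pow_succ, pow_succ, mul_assoc]

theorem T_add_int (x : ℝ) (z : ℤ) : T (x + z) = T x := by
  unfold T
  refine tsum_congr fun n => ?_
  rw [← phi_add_int (2 ^ n * x) (2 ^ n * z)]
  push_cast
  rw [mul_add]

theorem T_neg (x : ℝ) : T (-x) = T x := by
  unfold T
  refine tsum_congr fun n => ?_
  rw [mul_neg, phi_neg]

theorem T_one_sub (x : ℝ) : T (1 - x) = T x := by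
  rw [← T_neg x, ← T_add_int (-x) 1]
  congr 1
  push_cast
  ring

theorem T_zero : T 0 = 0 := by
  have h := T_eq_phi_add 0
  rw [phi_of_le_half le_rfl (by norm_num), mul_zero] at h
  linarith

theorem T_int (z : ℤ) : T z = 0 := by
  rw [← zero_add (z : ℝ), T_add_int, T_zero]

theorem T_fract (x : ℝ) : T (Int.fract x) = T x := by
  rw [← T_add_int (Int.fract x) ⌊x⌋, Int.fract_add_floor]

theorem T_of_le_half {x : ℝ} (h0 : 0 ≤ x) (h1 : x ≤ 1 / 2) : T x = x + T (2 * x) / 2 := by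
  rw [T_eq_phi_add, phi_of_le_half h0 h1]

theorem T_of_half_le {x : ℝ} (h0 : 1 / 2 ≤ x) (h1 : x ≤ 1) : T x = 1 - x + T (2 * x - 1) / 2 := by
  rw [T_eq_phi_add, phi_of_half_le h0 h1, ← T_add_int (2 * x - 1) 1]
  congr 3
  push_cast
  ring

theorem T_pos {x : ℝ} (h0 : 0 < x) (h1 : x < 1) : 0 < T x := by
  have h := T_nonneg (2 * x)
  rw [T_eq_phi_add]
  rcases le_total x (1 / 2) with hx | hx
  · rw [phi_of_le_half h0.le hx]
    linarith
  · rw [phi_of_half_le hx h1.le]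
    linarith

theorem T_half : T (1 / 2) = 1 / 2 := by
  rw [T_of_le_half (by norm_num) le_rfl]
  have h : T (2 * (1 / 2)) = 0 := by
    have := T_int 1
    norm_num at this ⊢
    exact this
  rw [h]
  norm_num

theorem T_one_sixth : T (1 / 6) = 1 / 2 := by
  have h1 := T_of_le_half (x := 1 / 3) (by norm_num) (by norm_num)
  have h2 := T_one_sub (1 / 3)
  have h3 := T_of_le_half (x := 1 / 6) (by norm_num) (by norm_num)
  norm_num at h1 h2 h3
  linarith

theorem T_inv_two_pow (n : ℕ) : T (1 / 2 ^ n) = n / 2 ^ n := by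
  induction n with
  | zero => simpa using T_int 1
  | succ n ih =>
    have hp : (1:ℝ) ≤ 2 ^ n := one_le_pow₀ (by norm_num)
    have hle : (1:ℝ) / 2 ^ (n + 1) ≤ 1 / 2 := by
      rw [pow_succ]
      gcongr
      linarith
    have he : (2:ℝ) * (1 / 2 ^ (n + 1)) = 1 / 2 ^ n := by
      rw [pow_succ]
      field_simp
    rw [T_of_le_half (by positivity) hle, he, ih, pow_succ]
    push_cast
    field_simp
    ring

/-! ### Binary digits -/

theorem eps_succ (n : ℕ) (x : ℝ) : eps (n + 1) x = ⌊2 ^ (n + 1) * x⌋ - 2 * ⌊2 ^ n * x⌋ := rfl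

theorem floor_two_mul_sub (z : ℝ) : ⌊2 * z⌋ - 2 * ⌊z⌋ = 0 ∨ ⌊2 * z⌋ - 2 * ⌊z⌋ = 1 := by
  have h1 : 2 * ⌊z⌋ ≤ ⌊2 * z⌋ := Int.le_floor.2 (by push_cast; linarith [Int.floor_le z])
  have h2 : ⌊2 * z⌋ < 2 * ⌊z⌋ + 2 :=
    Int.floor_lt.2 (by push_cast; linarith [Int.lt_floor_add_one z])
  omega

theorem floor_eq_of_floor_two_mul_eq {z w : ℝ} (h : ⌊2 * z⌋ = ⌊2 * w⌋) : ⌊z⌋ = ⌊w⌋ := by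
  have h1 := floor_two_mul_sub z
  have h2 := floor_two_mul_sub w
  omega

theorem eps_succ_eq_zero_or_one (n : ℕ) (x : ℝ) : eps (n + 1) x = 0 ∨ eps (n + 1) x = 1 := by
  rw [eps_succ, pow_succ', mul_assoc]
  exact floor_two_mul_sub _

theorem D_zero (x : ℝ) : D 0 x = 0 := by simp [D]

theorem D_succ (n : ℕ) (x : ℝ) : D (n + 1) x = D n x + (1 - 2 * eps (n + 1) x) := by
  rw [D, Finset.sum_Icc_succ_top (by omega), D]

theorem D_succ_eq (n : ℕ) (x : ℝ) : D (n + 1) x = D n x + 1 ∨ D (n + 1) x = D n x - 1 := by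
  rw [D_succ]
  have := eps_succ_eq_zero_or_one n x
  omega

theorem D_add (N j : ℕ) (x : ℝ) : D (N + j) x = D N x + D j (2 ^ N * x) := by
  induction j with
  | zero => simp [D_zero]
  | succ j ih =>
    rw [← add_assoc, D_succ, ih, D_succ, eps_succ, eps_succ, ← mul_assoc, ← mul_assoc, ← pow_add,
      ← pow_add, add_assoc N j 1, add_comm j N, show j + 1 + N = N + (j + 1) by ring]
    ring

theorem D_add_int (j : ℕ) (x : ℝ) (z : ℤ) : D j (x + z) = D j x := by
  have h : ∀ n : ℕ, ⌊2 ^ n * (x + z)⌋ = ⌊2 ^ n * x⌋ + 2 ^ n * z := fun n => by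
    rw [← Int.floor_add_intCast]
    push_cast
    rw [mul_add]
  induction j with
  | zero => simp [D_zero]
  | succ j ih =>
    rw [D_succ, ih, D_succ, eps_succ, eps_succ, h, h]
    ring

theorem D_fract (j : ℕ) (x : ℝ) : D j (Int.fract x) = D j x := by
  rw [← D_add_int j (Int.fract x) ⌊x⌋, Int.fract_add_floor]

theorem floor_pow_eq_of_le {x w : ℝ} {n N : ℕ} (h : ⌊2 ^ N * x⌋ = ⌊2 ^ N * w⌋) (hn : n ≤ N) :
    ⌊2 ^ n * x⌋ = ⌊2 ^ n * w⌋ := by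
  induction N, hn using Nat.le_induction with
  | base => exact h
  | succ N _ ih =>
    rw [pow_succ', mul_assoc, mul_assoc] at h
    exact ih (floor_eq_of_floor_two_mul_eq h)

theorem D_congr {x w : ℝ} {N : ℕ} (h : ⌊2 ^ N * x⌋ = ⌊2 ^ N * w⌋) : D N x = D N w := by
  induction N with
  | zero => simp [D_zero]
  | succ N ih =>
    rw [D_succ, D_succ, ih (floor_pow_eq_of_le h (Nat.le_succ N)), eps_succ, eps_succ, h,
      floor_pow_eq_of_le h (Nat.le_succ N)]

theorem D_one_of_lt {x : ℝ} (h0 : 0 ≤ x) (h1 : x < 1 / 2) : D 1 x = 1 := by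
  have h2 : ⌊2 * x⌋ = 0 := Int.floor_eq_zero_iff.2 ⟨by linarith, by linarith⟩
  have h3 : ⌊x⌋ = 0 := Int.floor_eq_zero_iff.2 ⟨by linarith, by linarith⟩
  rw [← zero_add 1, D_succ, D_zero, eps_succ]
  simp [h2, h3]

theorem D_one_of_ge {x : ℝ} (h0 : 1 / 2 ≤ x) (h1 : x < 1) : D 1 x = -1 := by
  have h2 : ⌊2 * x⌋ = 1 := Int.floor_eq_iff.2 ⟨by push_cast; linarith, by push_cast; linarith⟩
  have h3 : ⌊x⌋ = 0 := Int.floor_eq_zero_iff.2 ⟨by linarith, by linarith⟩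
  rw [← zero_add 1, D_succ, D_zero, eps_succ]
  simp [h2, h3]

theorem D_succ_of_lt {x : ℝ} (h0 : 0 ≤ x) (h1 : x < 1 / 2) (j : ℕ) :
    D (j + 1) x = 1 + D j (2 * x) := by
  rw [add_comm j 1, D_add, D_one_of_lt h0 h1, pow_one]

theorem D_succ_of_ge {x : ℝ} (h0 : 1 / 2 ≤ x) (h1 : x < 1) (j : ℕ) :
    D (j + 1) x = -1 + D j (2 * x - 1) := by
  rw [add_comm j 1, D_add, D_one_of_ge h0 h1, pow_one, ← D_add_int j (2 * x - 1) 1]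
  congr 2
  push_cast
  ring

theorem D_at_zero (j : ℕ) : D j 0 = j := by
  induction j with
  | zero => simp [D_zero]
  | succ j ih =>
    rw [D_succ_of_lt le_rfl (by norm_num), mul_zero, ih]
    push_cast
    ring

theorem D_emod_two (j : ℕ) (x : ℝ) : (D j x - j) % 2 = 0 := by
  induction j with
  | zero => simp [D_zero]
  | succ j ih =>
    have := D_succ_eq j x
    push_cast
    omega

theorem D_one_sub {x : ℝ} {N : ℕ} (h : ∀ n ≤ N, ∀ k : ℤ, 2 ^ n * x ≠ k) :
    D N (1 - x) = -D N x := by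
  have hf : ∀ n ≤ N, ⌊2 ^ n * (1 - x)⌋ = 2 ^ n - 1 - ⌊2 ^ n * x⌋ := fun n hn => by
    rw [Int.floor_eq_iff]
    push_cast
    have h1 := (Int.floor_le (2 ^ n * x)).lt_of_ne (h n hn _).symm
    have h2 := Int.lt_floor_add_one (2 ^ n * x)
    constructor <;> linarith
  induction N with
  | zero => simp [D_zero]
  | succ N ih =>
    rw [D_succ, D_succ, ih (fun n hn => h n (by omega)) (fun n hn => hf n (by omega)), eps_succ,
      eps_succ, hf _ le_rfl, hf N (by omega), pow_succ]
    ring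

/-- A walk `D · x` that is positive at `i` and nonpositive at a later time vanishes in between. -/
theorem exists_D_eq_zero_of_pos {x : ℝ} {i j : ℕ} (hij : i ≤ j) (hi : 0 < D i x)
    (hj : D j x ≤ 0) : ∃ n, i < n ∧ D n x = 0 := by
  induction j, hij using Nat.le_induction with
  | base => omega
  | succ j hij ih =>
    by_cases h : D j x ≤ 0
    · exact ih h
    · exact ⟨j + 1, by omega, by have := D_succ_eq j x; omega⟩

theorem exists_D_eq_zero_of_neg {x : ℝ} {i j : ℕ} (hij : i ≤ j) (hi : D i x < 0)
    (hj : 0 ≤ D j x) : ∃ n, i < n ∧ D n x = 0 := by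
  induction j, hij using Nat.le_induction with
  | base => omega
  | succ j hij ih =>
    by_cases h : 0 ≤ D j x
    · exact ih h
    · exact ⟨j + 1, by omega, by have := D_succ_eq j x; omega⟩

/-! ### Self-affinity of the Takagi function -/

theorem phi_sub_phi {x z : ℝ} (h0 : ⌊2 * z⌋ ≤ 2 * x) (h1 : 2 * x ≤ ⌊2 * z⌋ + 1) :
    phi x - phi z = D 1 z * (x - z) := by
  have hz0 := Int.floor_le z
  have hz1 := Int.lt_floor_add_one z
  have hw0 := Int.floor_le (2 * z)
  have hw1 := Int.lt_floor_add_one (2 * z)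
  have hx : phi x = phi (x - ⌊z⌋) := by
    rw [← phi_add_int (x - ⌊z⌋) ⌊z⌋, sub_add_cancel]
  have hz : phi z = phi (z - ⌊z⌋) := by
    rw [← phi_add_int (z - ⌊z⌋) ⌊z⌋, sub_add_cancel]
  have hD : D 1 z = D 1 (z - ⌊z⌋) := (D_fract 1 z).symm
  rw [hx, hz, hD]
  rcases floor_two_mul_sub z with h | h
  · have h' : (⌊2 * z⌋ : ℝ) = 2 * ⌊z⌋ := by exact_mod_cast sub_eq_zero.1 h
    rw [h'] at h0 h1 hw0 hw1
    rw [phi_of_le_half, phi_of_le_half, D_one_of_lt] <;> push_cast <;> linarith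
  · have h' : (⌊2 * z⌋ : ℝ) = 2 * ⌊z⌋ + 1 := by exact_mod_cast (by omega : ⌊2 * z⌋ = 2 * ⌊z⌋ + 1)
    rw [h'] at h0 h1 hw0 hw1
    rw [phi_of_half_le, phi_of_half_le, D_one_of_ge] <;> push_cast <;> linarith

/-- On the closed dyadic interval of level `N` containing `z`, the function `T` is an affine map of
slope `D N z` plus a scaled copy of itself. -/
theorem T_sub_T {x z : ℝ} {N : ℕ} (h0 : ⌊2 ^ N * z⌋ ≤ 2 ^ N * x)
    (h1 : 2 ^ N * x ≤ ⌊2 ^ N * z⌋ + 1) :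
    T x - T z = D N z * (x - z) + (T (2 ^ N * x) - T (2 ^ N * z)) / 2 ^ N := by
  induction N generalizing x z with
  | zero => simp [D_zero]
  | succ N ih =>
    have hp : (0:ℝ) < 2 ^ N := by positivity
    have e : ∀ w : ℝ, (2:ℝ) ^ (N + 1) * w = 2 ^ N * (2 * w) := fun w => by ring
    rw [e, e] at h0 h1
    have hlo : 2 ^ N * ⌊2 * z⌋ ≤ ⌊2 ^ N * (2 * z)⌋ := by
      rw [Int.le_floor]
      push_cast
      exact mul_le_mul_of_nonneg_left (Int.floor_le _) hp.le
    have hhi : ⌊2 ^ N * (2 * z)⌋ + 1 ≤ 2 ^ N * (⌊2 * z⌋ + 1) := by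
      rw [Int.add_one_le_iff, Int.floor_lt]
      push_cast
      exact mul_lt_mul_of_pos_left (Int.lt_floor_add_one _) hp
    have hlo' : (2:ℝ) ^ N * ⌊2 * z⌋ ≤ ⌊2 ^ N * (2 * z)⌋ := by exact_mod_cast hlo
    have hhi' : (⌊2 ^ N * (2 * z)⌋ : ℝ) + 1 ≤ 2 ^ N * (⌊2 * z⌋ + 1) := by exact_mod_cast hhi
    have hphi := phi_sub_phi (x := x) (z := z) (le_of_mul_le_mul_left (hlo'.trans h0) hp)
      (le_of_mul_le_mul_left (h1.trans hhi') hp)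
    have hT := ih h0 h1
    rw [T_eq_phi_add x, T_eq_phi_add z, add_comm N 1, D_add, pow_one, add_comm 1 N, e, e]
    push_cast
    rw [pow_succ, ← div_div]
    linear_combination hphi + hT / 2

/-! ### Monotonicity along positive walks -/

theorem T_le_of_le_D_aux (n : ℕ) {x : ℝ} (h0 : 0 ≤ x) (h1 : x < 1) {d : ℤ} (hd : 1 ≤ d)
    (h : ∀ j, 1 - d ≤ D j x) : T x ≤ d * (1 - x) + 1 / 2 ^ n := by
  induction n generalizing x d with
  | zero =>
    have hd' : (1:ℝ) ≤ d := by exact_mod_cast hd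
    have := T_le_one x
    have := mul_nonneg (by linarith : (0:ℝ) ≤ d) (by linarith : 0 ≤ 1 - x)
    simp
    linarith
  | succ n ih =>
    have he : (1:ℝ) / 2 ^ (n + 1) = 1 / 2 ^ n / 2 := by rw [pow_succ, div_div]
    rcases lt_or_ge x (1 / 2) with hx | hx
    · have hd' : (1:ℝ) ≤ d := by exact_mod_cast hd
      have h2 := ih (x := 2 * x) (by linarith) (by linarith) (d := d + 1) (by omega) fun j => by
        have := h (j + 1)
        rw [D_succ_of_lt h0 hx] at this
        omega
      push_cast at h2
      rw [T_of_le_half h0 hx.le, he]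
      linarith
    · have h3 := h 1
      rw [D_one_of_ge hx h1] at h3
      have h2 := ih (x := 2 * x - 1) (by linarith) (by linarith) (d := d - 1) (by omega) fun j => by
        have := h (j + 1)
        rw [D_succ_of_ge hx h1] at this
        omega
      push_cast at h2
      rw [T_of_half_le hx h1.le, he]
      linarith

theorem T_le_of_le_D {x : ℝ} (h0 : 0 ≤ x) (h1 : x < 1) {d : ℤ} (hd : 1 ≤ d)
    (h : ∀ j, 1 - d ≤ D j x) : T x ≤ d * (1 - x) := by
  refine le_of_forall_pos_le_add fun e he => ?_
  obtain ⟨n, hn⟩ := exists_pow_lt_of_lt_one he (by norm_num : (1 / 2 : ℝ) < 1)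
  have := T_le_of_le_D_aux n h0 h1 hd h
  rw [one_div_pow] at hn
  linarith

theorem lt_half_of_D_one_pos {x : ℝ} (h1 : x < 1) (h : 0 < D 1 x) : x < 1 / 2 := by
  by_contra hx
  rw [D_one_of_ge (not_lt.1 hx) h1] at h
  omega

theorem T_le_half_of_D_pos {x : ℝ} (h0 : 0 ≤ x) (h1 : x < 1) (h : ∀ j, 1 ≤ j → 0 < D j x) :
    T x ≤ 1 / 2 := by
  have hx := lt_half_of_D_one_pos h1 (h 1 le_rfl)
  have h2 := T_le_of_le_D (x := 2 * x) (by linarith) (by linarith) (d := 1) le_rfl fun j => by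
    have := h (j + 1) (by omega)
    rw [D_succ_of_lt h0 hx] at this
    omega
  rw [T_of_le_half h0 hx.le]
  push_cast at h2
  linarith

theorem exists_floor_eq_and_floor_succ_ne {x x' : ℝ} (h0 : 0 ≤ x) (hlt : x < x') (h1 : x' < 1) :
    ∃ N : ℕ, ⌊2 ^ N * x⌋ = ⌊2 ^ N * x'⌋ ∧ ⌊2 ^ (N + 1) * x⌋ ≠ ⌊2 ^ (N + 1) * x'⌋ := by
  by_contra! hcon
  have hall : ∀ N : ℕ, ⌊2 ^ N * x⌋ = ⌊2 ^ N * x'⌋ := fun N => by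
    induction N with
    | zero =>
      rw [pow_zero, one_mul, one_mul, Int.floor_eq_zero_iff.2 ⟨h0, by linarith⟩,
        Int.floor_eq_zero_iff.2 ⟨by linarith, h1⟩]
    | succ N ih => exact hcon N ih
  obtain ⟨n, hn⟩ := exists_pow_lt_of_lt_one (sub_pos.2 hlt) (by norm_num : (1 / 2 : ℝ) < 1)
  have hp : (0:ℝ) < 2 ^ n := by positivity
  rw [one_div_pow, div_lt_iff₀ hp] at hn
  have h2 := Int.floor_le (2 ^ n * x)
  have h3 := Int.lt_floor_add_one (2 ^ n * x')
  rw [← hall n] at h3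
  linarith

/-- `T` is strictly increasing on the non-dyadic points all of whose partial digit sums are
positive. -/
theorem T_lt_T_of_D_pos {x x' : ℝ} (h0 : 0 ≤ x) (hlt : x < x') (h1 : x' < 1)
    (hx : ∀ j, 1 ≤ j → 0 < D j x) (hx' : ∀ j, 1 ≤ j → 0 < D j x')
    (hnd : ∀ (n : ℕ) (k : ℤ), 2 ^ n * x' ≠ k) : T x < T x' := by
  obtain ⟨N, hN, hN1⟩ := exists_floor_eq_and_floor_succ_ne h0 hlt h1
  have hp : (0:ℝ) < 2 ^ N := by positivity
  have hDN := D_congr hN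
  obtain ⟨s, hs⟩ : ∃ s, s = Int.fract (2 ^ N * x) := ⟨_, rfl⟩
  obtain ⟨s', hs'⟩ : ∃ s', s' = Int.fract (2 ^ N * x') := ⟨_, rfl⟩
  have hs0 : 0 ≤ s := hs ▸ Int.fract_nonneg _
  have hs1 : s' < 1 := hs' ▸ Int.fract_lt_one _
  have hxs : 2 ^ N * x = s + ⌊2 ^ N * x⌋ := by rw [hs, Int.fract_add_floor]
  have hxs' : 2 ^ N * x' = s' + ⌊2 ^ N * x⌋ := by rw [hs', hN, Int.fract_add_floor]
  have hss : s < s' := by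
    have := mul_lt_mul_of_pos_left hlt hp
    linarith
  have hfl : ∀ w r : ℝ, 2 ^ N * w = r + ⌊2 ^ N * x⌋ →
      ⌊2 ^ (N + 1) * w⌋ = ⌊2 * r⌋ + 2 * ⌊2 ^ N * x⌋ := fun w r hw => by
    rw [pow_succ', mul_assoc, hw, ← Int.floor_add_intCast]
    push_cast
    congr 1
    ring
  have hne : ⌊2 * s⌋ ≠ ⌊2 * s'⌋ := fun h => hN1 (by rw [hfl x s hxs, hfl x' s' hxs', h])
  have hs2 : s < 1 / 2 := by
    by_contra h
    apply hne
    have e : ⌊2 * s⌋ = 1 :=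
      Int.floor_eq_iff.2 ⟨by push_cast; linarith, by push_cast; linarith⟩
    have e' : ⌊2 * s'⌋ = 1 :=
      Int.floor_eq_iff.2 ⟨by push_cast; linarith, by push_cast; linarith⟩
    rw [e, e']
  have hs2' : 1 / 2 ≤ s' := by
    by_contra h
    apply hne
    have e : ⌊2 * s⌋ = 0 :=
      Int.floor_eq_iff.2 ⟨by push_cast; linarith, by push_cast; linarith⟩
    have e' : ⌊2 * s'⌋ = 0 :=
      Int.floor_eq_iff.2 ⟨by push_cast; linarith, by push_cast; linarith⟩
    rw [e, e']
  have hs3' : 1 / 2 < s' := by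
    refine lt_of_le_of_ne hs2' fun h => hnd (N + 1) (1 + 2 * ⌊2 ^ N * x⌋) ?_
    rw [pow_succ', mul_assoc, hxs', ← h]
    push_cast
    ring
  have hDs : ∀ j, D (N + j) x = D N x + D j s := fun j => by rw [D_add, hs, D_fract]
  have hDs' : ∀ j, D (N + j) x' = D N x + D j s' := fun j => by rw [D_add, hs', D_fract, hDN]
  have hk : 2 ≤ D N x := by
    have h := hDs' 1
    rw [D_one_of_ge hs2' hs1] at h
    have := hx' (N + 1) (by omega)
    omega
  have hT := T_sub_T (x := x') (z := x) (N := N) (by rw [hN]; exact Int.floor_le _)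
    (by rw [hN]; exact (Int.lt_floor_add_one _).le)
  rw [hxs, hxs', T_add_int, T_add_int] at hT
  have hdiff : x' - x = (s' - s) / 2 ^ N := by
    rw [eq_div_iff hp.ne']
    linarith
  have hup := T_le_of_le_D (x := 2 * s) (by linarith) (by linarith) (d := D N x + 1) (by omega)
    fun j => by
      have h := hDs (j + 1)
      rw [D_succ_of_lt hs0 hs2] at h
      have := hx (N + (j + 1)) (by omega)
      omega
  have hlow := T_of_half_le hs2' hs1.le
  have hnn := T_nonneg (2 * s' - 1)
  have hup' := T_of_le_half hs0 hs2.le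
  have hk' : (2:ℝ) ≤ D N x := by exact_mod_cast hk
  push_cast at hup
  have hpos : 0 < D N x * (s' - s) + (T s' - T s) := by nlinarith
  have hfin : T x' - T x = (D N x * (s' - s) + (T s' - T s)) / 2 ^ N := by
    rw [hT, hdiff]
    ring
  have := div_pos hpos hp
  linarith

/-! ### Existence of solutions along positive walks -/

theorem D_thirds (j : ℕ) : 0 ≤ D j (1 / 3) ∧ -1 ≤ D j (2 / 3) := by
  induction j with
  | zero => simp [D_zero]
  | succ j ih =>
    rw [D_succ_of_lt (by norm_num) (by norm_num), D_succ_of_ge (by norm_num) (by norm_num)]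
    norm_num at ih ⊢
    omega

theorem D_one_sixth_pos {j : ℕ} (hj : 1 ≤ j) : 0 < D j (1 / 6) := by
  obtain ⟨i, rfl⟩ := Nat.exists_eq_add_of_le' hj
  rw [D_succ_of_lt (by norm_num) (by norm_num)]
  have := (D_thirds i).1
  norm_num at this ⊢
  omega

/-- Every value in `[0, 1/2]` is attained at a point whose partial digit sums are all positive:
the largest solution in `[0, 1/6]` works. -/
theorem exists_T_eq_and_D_pos {v : ℝ} (hv0 : 0 ≤ v) (hv1 : v ≤ 1 / 2) :
    ∃ t, 0 ≤ t ∧ t ≤ 1 / 6 ∧ T t = v ∧ ∀ j, 1 ≤ j → 0 < D j t := by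
  have hivt : ∀ b ≤ (1 / 6 : ℝ), T b ≤ v → ∃ t ∈ Icc b (1 / 6), T t = v := fun b hb hTb =>
    intermediate_value_Icc hb continuous_T.continuousOn ⟨hTb, by rwa [T_one_sixth]⟩
  have hcomp : IsCompact (Icc (0:ℝ) (1 / 6) ∩ T ⁻¹' {v}) :=
    isCompact_Icc.inter_right (isClosed_singleton.preimage continuous_T)
  obtain ⟨t₀, ht₀, hTt₀⟩ := hivt 0 (by norm_num) (by rwa [T_zero])
  obtain ⟨t, ⟨⟨ht0, ht1⟩, hTt⟩, hmax⟩ := hcomp.exists_isGreatest ⟨t₀, ht₀, hTt₀⟩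
  refine ⟨t, ht0, ht1, hTt, fun j hj => ?_⟩
  by_contra hneg
  obtain ⟨n, hn, hDn⟩ := exists_D_eq_zero_of_pos (x := t) hj
    (by rw [D_one_of_lt ht0 (by linarith)]; exact one_pos) (not_lt.1 hneg)
  have hp : (0:ℝ) < 2 ^ n := by positivity
  obtain ⟨b, hb⟩ : ∃ b : ℝ, b = ((⌊2 ^ n * t⌋ + 1 : ℤ) : ℝ) / 2 ^ n := ⟨_, rfl⟩
  have hb' : 2 ^ n * b = ((⌊2 ^ n * t⌋ + 1 : ℤ) : ℝ) := by
    rw [hb]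
    field_simp
  have hb'' : 2 ^ n * b = ⌊2 ^ n * t⌋ + 1 := by exact_mod_cast hb'
  have htb : t < b := by
    have := Int.lt_floor_add_one (2 ^ n * t)
    rw [← hb''] at this
    exact lt_of_mul_lt_mul_left this hp.le
  have hb6 : b ≤ 1 / 6 := by
    by_contra h
    have hfl : ⌊2 ^ n * (1 / 6 : ℝ)⌋ = ⌊2 ^ n * t⌋ := by
      rw [Int.floor_eq_iff, ← hb'']
      exact ⟨(Int.floor_le _).trans (mul_le_mul_of_nonneg_left ht1 hp.le),
        mul_lt_mul_of_pos_left (not_le.1 h) hp⟩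
    have h6 := D_one_sixth_pos (j := n) (by omega)
    rw [D_congr hfl, hDn] at h6
    omega
  have hTb := T_sub_T (x := b) (z := t) (N := n) (by rw [hb'']; linarith) hb''.le
  rw [hDn, hb', T_int] at hTb
  have hTn := div_nonneg (T_nonneg (2 ^ n * t)) hp.le
  have hTv : T t = v := hTt
  obtain ⟨t', ht', hTt'⟩ := hivt b hb6 (by
    rw [zero_sub, neg_div] at hTb
    push_cast at hTb
    linarith)
  have := hmax ⟨⟨by linarith [ht'.1], ht'.2⟩, hTt'⟩
  linarith [ht'.1]

/-! ### Finite level sets contain no dyadic rationals and no recurrent walks -/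

theorem ne_int_of_fract_eq_half {x : ℝ} {N n : ℕ} (h : Int.fract (2 ^ N * x) = 1 / 2) (hn : n ≤ N)
    (k : ℤ) : 2 ^ n * x ≠ k := fun hk => by
  obtain ⟨i, rfl⟩ := Nat.exists_eq_add_of_le hn
  have : (2:ℝ) ^ (n + i) * x = ((2 ^ i * k : ℤ) : ℝ) := by
    push_cast
    rw [← hk]
    ring
  rw [this, Int.fract_intCast] at h
  norm_num at h

theorem D_half_sub (d : ℕ) : D (d + 1) (1 / 2 - 1 / 2 ^ (d + 2)) = 1 - d := by
  have hp : (1:ℝ) ≤ 2 ^ d := one_le_pow₀ (by norm_num)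
  have e1 : (1:ℝ) / 2 ^ (d + 1) = 1 / 2 ^ d / 2 := by rw [pow_succ, div_div]
  have e2 : (1:ℝ) / 2 ^ (d + 2) = 1 / 2 ^ d / 4 := by rw [pow_add, div_div]; norm_num
  have hq : (1:ℝ) / 2 ^ d ≤ 1 := div_le_one_of_le₀ hp (by positivity)
  have hq0 : (0:ℝ) < 1 / 2 ^ d := by positivity
  have e3 : (2:ℝ) ^ d * (1 / 2 ^ (d + 1)) = 1 / 2 := by rw [e1]; field_simp
  have hfr : Int.fract ((2:ℝ) ^ d * (1 / 2 ^ (d + 1))) = 1 / 2 := by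
    rw [e3, Int.fract_eq_self.2 (by norm_num)]
  rw [D_succ_of_lt (by linarith) (by linarith),
    show (2:ℝ) * (1 / 2 - 1 / 2 ^ (d + 2)) = 1 - 1 / 2 ^ (d + 1) by rw [e1, e2]; ring,
    D_one_sub (fun n hn k => ne_int_of_fract_eq_half hfr hn k), D_congr (w := 0), D_at_zero]
  · ring
  · rw [e3]
    norm_num

theorem T_half_sub (d : ℕ) : T (1 / 2 - 1 / 2 ^ (d + 2)) = 1 / 2 + d / 2 ^ (d + 2) := by
  have hp : (1:ℝ) ≤ 2 ^ d := one_le_pow₀ (by norm_num)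
  have e1 : (1:ℝ) / 2 ^ (d + 1) = 1 / 2 ^ d / 2 := by rw [pow_succ, div_div]
  have e2 : (1:ℝ) / 2 ^ (d + 2) = 1 / 2 ^ d / 4 := by rw [pow_add, div_div]; norm_num
  have hq : (1:ℝ) / 2 ^ d ≤ 1 := div_le_one_of_le₀ hp (by positivity)
  have hq0 : (0:ℝ) < 1 / 2 ^ d := by positivity
  rw [T_of_le_half (by linarith) (by linarith),
    show (2:ℝ) * (1 / 2 - 1 / 2 ^ (d + 2)) = 1 - 1 / 2 ^ (d + 1) by rw [e1, e2]; ring,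
    T_one_sub, T_inv_two_pow, pow_succ, pow_succ]
  push_cast
  field_simp
  ring

/-- A dyadic point whose walk sits at height `d ≥ 0` before its last digit has a strictly smaller
dyadic point at the same level whose walk sits at height `1` before its last digit. -/
theorem exists_lt_T_eq {x : ℝ} (h0 : 0 ≤ x) {N d : ℕ} (hN : Int.fract (2 ^ N * x) = 1 / 2)
    (hd : D N x = d) :
    ∃ x', 0 ≤ x' ∧ x' < x ∧ T x' = T x ∧ ∃ M, Int.fract (2 ^ M * x') = 1 / 2 ∧ D M x' = 1 := by
  have hp : (0:ℝ) < 2 ^ N := by positivity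
  have hpd : (1:ℝ) ≤ 2 ^ d := one_le_pow₀ (by norm_num)
  have e2 : (1:ℝ) / 2 ^ (d + 2) = 1 / 2 ^ d / 4 := by rw [pow_add, div_div]; norm_num
  have hq : (1:ℝ) / 2 ^ d ≤ 1 := div_le_one_of_le₀ hpd (by positivity)
  have hq0 : (0:ℝ) < 1 / 2 ^ d := by positivity
  have hx : 2 ^ N * x = 1 / 2 + ⌊2 ^ N * x⌋ := by rw [← hN, Int.fract_add_floor]
  have hx' : 2 ^ N * (x - 1 / 2 ^ (d + 2) / 2 ^ N) =
      1 / 2 - 1 / 2 ^ (d + 2) + ⌊2 ^ N * x⌋ := by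
    rw [mul_sub, mul_div_cancel₀ _ hp.ne']
    linarith
  have hfl : ⌊2 ^ N * (x - 1 / 2 ^ (d + 2) / 2 ^ N)⌋ = ⌊2 ^ N * x⌋ := by
    rw [hx', Int.floor_eq_iff]
    constructor <;> linarith
  have hfl0 : (0:ℝ) ≤ ⌊2 ^ N * x⌋ := by
    exact_mod_cast Int.floor_nonneg.2 (mul_nonneg hp.le h0)
  refine ⟨x - 1 / 2 ^ (d + 2) / 2 ^ N, ?_, ?_, ?_, N + (d + 1), ?_, ?_⟩
  · refine nonneg_of_mul_nonneg_right ?_ hp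
    rw [hx']
    linarith
  · have : (0:ℝ) < 1 / 2 ^ (d + 2) / 2 ^ N := by positivity
    linarith
  · have hT := T_sub_T (x := x - 1 / 2 ^ (d + 2) / 2 ^ N) (z := x) (N := N)
      (by rw [hx']; linarith) (by rw [hx']; linarith)
    have hTx : T (2 ^ N * x) = 1 / 2 := by rw [hx, T_add_int, T_half]
    rw [hTx, hx', T_add_int, T_half_sub, hd] at hT
    push_cast at hT
    rw [← sub_eq_zero, hT]
    field_simp
    ring
  · rw [Int.fract_eq_iff]
    refine ⟨by norm_num, by norm_num, 2 ^ d + 2 ^ (d + 1) * ⌊2 ^ N * x⌋ - 1, ?_⟩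
    rw [show (2:ℝ) ^ (N + (d + 1)) * (x - 1 / 2 ^ (d + 2) / 2 ^ N) =
      2 ^ (d + 1) * (2 ^ N * (x - 1 / 2 ^ (d + 2) / 2 ^ N)) by ring, hx']
    push_cast
    field_simp
    ring
  · rw [D_add, D_congr hfl, hd, hx', D_add_int, D_half_sub]
    ring

theorem not_dyadic_of_finite {y : ℝ} (hy : 0 < y) (hfin : (L y).Finite) {x : ℝ} (hx : x ∈ L y)
    (n : ℕ) (k : ℤ) : 2 ^ n * x ≠ k := by
  intro hnk
  obtain ⟨⟨h0, h1⟩, hT⟩ := hx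
  -- the last nonzero binary digit of `x`
  obtain ⟨N, hN⟩ : ∃ N : ℕ, Int.fract (2 ^ N * x) = 1 / 2 := by
    induction n generalizing k with
    | zero =>
      rw [pow_zero, one_mul] at hnk
      rw [hnk, T_int] at hT
      exact absurd hT hy.ne
    | succ n ih =>
      rcases Int.even_or_odd' k with ⟨c, rfl | rfl⟩
      · refine ih c ?_
        rw [pow_succ'] at hnk
        push_cast at hnk
        linarith
      · refine ⟨n, Int.fract_eq_iff.2 ⟨by norm_num, by norm_num, c, ?_⟩⟩
        rw [pow_succ'] at hnk
        push_cast at hnk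
        linarith
  have hdesc : ∀ z ∈ L y, (∃ N, Int.fract (2 ^ N * z) = 1 / 2 ∧ 0 ≤ D N z) →
      ∃ z' ∈ L y, z' < z ∧ ∃ M, Int.fract (2 ^ M * z') = 1 / 2 ∧ D M z' = 1 := by
    rintro z ⟨hz, hTz⟩ ⟨M, hM, hD⟩
    obtain ⟨z', hz0, hlt, hTz', h⟩ := exists_lt_T_eq hz.1 hM (Int.toNat_of_nonneg hD).symm
    exact ⟨z', ⟨⟨hz0, hlt.le.trans hz.2⟩, hTz'.trans hTz⟩, hlt, h⟩
  obtain ⟨z, hz, hzD⟩ : ∃ z ∈ L y, ∃ M, Int.fract (2 ^ M * z) = 1 / 2 ∧ 0 ≤ D M z := by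
    rcases le_total 0 (D N x) with h | h
    · exact ⟨x, ⟨⟨h0, h1⟩, hT⟩, N, hN, h⟩
    · refine ⟨1 - x, ⟨⟨by linarith, by linarith⟩, by rw [T_one_sub, hT]⟩, N, ?_, ?_⟩
      · refine Int.fract_eq_iff.2 ⟨by norm_num, by norm_num, 2 ^ N - 1 - ⌊2 ^ N * x⌋, ?_⟩
        have := Int.fract_add_floor (2 ^ N * x)
        push_cast
        linarith
      · rw [D_one_sub fun n hn k => ne_int_of_fract_eq_half hN hn k]
        omega
  obtain ⟨w, hw, -, hwD⟩ := hdesc z hz hzD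
  obtain ⟨u, ⟨hu, M, hM, hMD⟩, hmin⟩ :=
    (hfin.subset (sep_subset (L y) fun z => ∃ M, Int.fract (2 ^ M * z) = 1 / 2 ∧ D M z = 1)
      ).exists_minimal ⟨w, hw, hwD⟩
  obtain ⟨u', hu', hlt, h⟩ := hdesc u hu ⟨M, hM, by omega⟩
  exact absurd (hmin ⟨hu', h⟩ hlt.le) (not_le.2 hlt)

theorem bddAbove_zeros_of_finite {y : ℝ} (hy : 0 < y) (hfin : (L y).Finite) {x : ℝ}
    (hx : x ∈ L y) : BddAbove {n : ℕ | D n x = 0} := by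
  have hnd := not_dyadic_of_finite hy hfin hx
  by_contra hunb
  rw [not_bddAbove_iff] at hunb
  obtain ⟨δ, hδ, hball⟩ := Metric.isOpen_iff.1
    (hfin.subset (sdiff_subset (t := {x}))).isClosed.isOpen_compl x (by simp)
  obtain ⟨B, hB⟩ := exists_pow_lt_of_lt_one hδ (by norm_num : (1 / 2 : ℝ) < 1)
  obtain ⟨n, hn, hBn⟩ := hunb B
  have hp : (0:ℝ) < 2 ^ n := by positivity
  have hnδ : 1 / 2 ^ n < δ := by
    rw [← one_div_pow]
    exact (pow_le_pow_of_le_one (by norm_num) (by norm_num) hBn.le).trans_lt hB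
  obtain ⟨p, hp'⟩ : ∃ p, p = Int.fract (2 ^ n * x) := ⟨_, rfl⟩
  have hp0 : 0 ≤ p := hp' ▸ Int.fract_nonneg _
  have hp1 : p < 1 := hp' ▸ Int.fract_lt_one _
  have hxp : 2 ^ n * x = p + ⌊2 ^ n * x⌋ := by rw [hp', Int.fract_add_floor]
  have hphalf : p ≠ 1 / 2 := fun h => hnd (n + 1) (1 + 2 * ⌊2 ^ n * x⌋) (by
    rw [h] at hxp
    rw [pow_succ', mul_assoc]
    push_cast
    linarith)
  have hx1 : x < 1 := hx.1.2.lt_of_ne fun h => hnd 0 1 (by simp [h])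
  have hx' : 2 ^ n * (x + (1 - 2 * p) / 2 ^ n) = 1 - p + ⌊2 ^ n * x⌋ := by
    rw [mul_add, mul_div_cancel₀ _ hp.ne']
    linarith
  have hfl0 : (0:ℝ) ≤ ⌊2 ^ n * x⌋ := by
    exact_mod_cast Int.floor_nonneg.2 (mul_nonneg hp.le hx.1.1)
  have hfl1 : (⌊2 ^ n * x⌋ : ℝ) + 1 ≤ 2 ^ n := by
    have : ⌊2 ^ n * x⌋ + 1 ≤ 2 ^ n := by
      rw [Int.add_one_le_iff, Int.floor_lt]
      push_cast
      exact mul_lt_of_lt_one_right hp hx1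
    exact_mod_cast this
  have hT := T_sub_T (x := x + (1 - 2 * p) / 2 ^ n) (z := x) (N := n)
    (by rw [hx']; linarith) (by rw [hx']; linarith)
  rw [show D n x = 0 from hn, hx', T_add_int, T_one_sub, hp', T_fract, ← hp'] at hT
  have hmem : x + (1 - 2 * p) / 2 ^ n ∈ L y := by
    refine ⟨⟨nonneg_of_mul_nonneg_right (by rw [hx']; linarith) hp,
      le_of_mul_le_mul_left (by rw [hx']; linarith) hp⟩, ?_⟩
    rw [Int.cast_zero, zero_mul, sub_self, zero_div, add_zero, sub_eq_zero] at hT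
    rw [hT, hx.2]
  have hne : (1 - 2 * p) / 2 ^ n ≠ 0 := div_ne_zero (fun h => hphalf (by linarith)) hp.ne'
  refine hball (?_ : x + (1 - 2 * p) / 2 ^ n ∈ Metric.ball x δ) ⟨hmem, by simpa using hne⟩
  rw [Metric.mem_ball, Real.dist_eq, add_sub_cancel_left, abs_div, abs_of_pos hp]
  refine lt_of_le_of_lt (div_le_div_of_nonneg_right ?_ hp.le) hnδ
  rw [abs_le]
  constructor <;> linarith

/-! ### Humps and the excursion decomposition -/

namespace BalancedOfOrder

variable {x₀ t : ℝ} {m : ℕ}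

theorem floor_eq (h : BalancedOfOrder x₀ m) (ht0 : 0 ≤ t) (ht1 : t < 1) :
    ((⌊2 ^ (2 * m) * (x₀ + t / 2 ^ (2 * m))⌋ : ℤ) : ℝ) = 2 ^ (2 * m) * x₀ := by
  obtain ⟨-, ⟨k, rfl⟩, -⟩ := h
  have hp : (0:ℝ) < 2 ^ (2 * m) := by positivity
  rw [mul_add, mul_div_cancel₀ _ hp.ne', mul_div_cancel₀ _ hp.ne', Int.floor_intCast_add,
    Int.floor_eq_zero_iff.2 ⟨ht0, ht1⟩, add_zero]

theorem D_hump (h : BalancedOfOrder x₀ m) (ht0 : 0 ≤ t) (ht1 : t < 1) (j : ℕ) :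
    D (2 * m + j) (x₀ + t / 2 ^ (2 * m)) = D j t := by
  have hfl := h.floor_eq ht0 ht1
  have hfl0 := h.floor_eq (t := 0) le_rfl one_pos
  rw [zero_div, add_zero] at hfl0
  have hD := D_congr (x := x₀ + t / 2 ^ (2 * m)) (w := x₀) (N := 2 * m)
    (by exact_mod_cast hfl.trans hfl0.symm)
  obtain ⟨-, ⟨k, rfl⟩, h0⟩ := h
  have hp : (0:ℝ) < 2 ^ (2 * m) := by positivity
  rw [D_add, hD, h0, zero_add, mul_add, mul_div_cancel₀ _ hp.ne', mul_div_cancel₀ _ hp.ne',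
    add_comm, D_add_int]

theorem T_hump (h : BalancedOfOrder x₀ m) (ht0 : 0 ≤ t) (ht1 : t ≤ 1) :
    T (x₀ + t / 2 ^ (2 * m)) = T x₀ + T t / 4 ^ m := by
  have hp : (0:ℝ) < 2 ^ (2 * m) := by positivity
  have hfl0 := h.floor_eq (t := 0) le_rfl one_pos
  rw [zero_div, add_zero] at hfl0
  have hT := T_sub_T (x := x₀ + t / 2 ^ (2 * m)) (z := x₀) (N := 2 * m)
    (by rw [mul_add, mul_div_cancel₀ _ hp.ne', hfl0]; linarith)
    (by rw [mul_add, mul_div_cancel₀ _ hp.ne', hfl0]; linarith)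
  obtain ⟨-, ⟨k, rfl⟩, h0⟩ := h
  have h4 : (2:ℝ) ^ (2 * m) = 4 ^ m := by rw [pow_mul]; norm_num
  rw [mul_add, mul_div_cancel₀ _ hp.ne', mul_div_cancel₀ _ hp.ne', add_comm (k : ℝ) t, T_add_int,
    T_int, h0, Int.cast_zero, zero_mul, zero_add, sub_zero] at hT
  rw [← h4]
  linarith

theorem mem_Icc_hump (h : BalancedOfOrder x₀ m) (ht0 : 0 ≤ t) (ht1 : t ≤ 1) :
    x₀ + t / 2 ^ (2 * m) ∈ Icc (0:ℝ) 1 := by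
  obtain ⟨⟨h0, h1⟩, ⟨k, rfl⟩, -⟩ := h
  have hp : (0:ℝ) < 2 ^ (2 * m) := by positivity
  have hk : (k : ℝ) + 1 ≤ 2 ^ (2 * m) := by
    rw [div_lt_one hp] at h1
    have h1' : k < 2 ^ (2 * m) := by exact_mod_cast h1
    exact_mod_cast Int.add_one_le_iff.2 h1'
  refine ⟨by positivity, ?_⟩
  rw [← add_div, div_le_one hp]
  linarith

theorem order_unique {n : ℕ} (h : BalancedOfOrder x₀ m) (h' : BalancedOfOrder x₀ n) : m = n := by
  have key : ∀ {a b : ℕ}, BalancedOfOrder x₀ a → BalancedOfOrder x₀ b → b ≤ a := by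
    intro a b ha hb
    by_contra hlt
    have hD := ha.D_hump (t := 0) le_rfl one_pos (2 * b - 2 * a)
    rw [zero_div, add_zero, D_at_zero, show 2 * a + (2 * b - 2 * a) = 2 * b by omega, hb.2.2] at hD
    omega
  exact le_antisymm (key h' h) (key h h')

theorem not_dyadic_of_hump (h : BalancedOfOrder x₀ m)
    (hnd : ∀ (n : ℕ) (k : ℤ), 2 ^ n * (x₀ + t / 2 ^ (2 * m)) ≠ k) (n : ℕ) (k : ℤ) :
    2 ^ n * t ≠ k := by
  intro hk
  obtain ⟨-, ⟨c, rfl⟩, -⟩ := h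
  refine hnd (2 * m + n) (2 ^ n * c + k) ?_
  push_cast
  rw [← hk, pow_add]
  field_simp

end BalancedOfOrder

/-- `x` leaves the balanced dyadic rational `x₀` along an excursion of sign `s` that never
returns to zero. -/
def FinalExcursion (s : ℤ) (x₀ x : ℝ) : Prop :=
  ∃ (m : ℕ) (t : ℝ), BalancedOfOrder x₀ m ∧ 0 < t ∧ t < 1 ∧ x = x₀ + t / 2 ^ (2 * m) ∧
    ∀ j, 1 ≤ j → 0 < s * D j t

theorem FinalExcursion.unique {s s' : ℤ} {x₀ x₁ x : ℝ} (h : FinalExcursion s x₀ x)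
    (h' : FinalExcursion s' x₁ x) : x₀ = x₁ ∧ 0 < s * s' := by
  have key : ∀ {s : ℤ} {a b : ℕ} {x₀ x₁ t u : ℝ}, BalancedOfOrder x₀ a → 0 < t → t < 1 →
      x = x₀ + t / 2 ^ (2 * a) → (∀ j, 1 ≤ j → 0 < s * D j t) → BalancedOfOrder x₁ b → 0 < u →
      u < 1 → x = x₁ + u / 2 ^ (2 * b) → b ≤ a := by
    intro s a b x₀ x₁ t u ha ht0 ht1 hx hs hb hu0 hu1 hx'
    by_contra hlt
    have h1 := ha.D_hump ht0.le ht1 (2 * b - 2 * a)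
    have h2 := hb.D_hump hu0.le hu1 0
    rw [← hx, show 2 * a + (2 * b - 2 * a) = 2 * b by omega] at h1
    rw [← hx', add_zero, D_zero] at h2
    have h3 := hs (2 * b - 2 * a) (by omega)
    rw [← h1, h2, mul_zero] at h3
    exact lt_irrefl _ h3
  obtain ⟨m, t, hm, ht0, ht1, hx, hs⟩ := h
  obtain ⟨n, u, hn, hu0, hu1, hx', hs'⟩ := h'
  obtain rfl : m = n := le_antisymm (key hn hu0 hu1 hx' hs' hm ht0 ht1 hx)
    (key hm ht0 ht1 hx hs hn hu0 hu1 hx')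
  have hp : (0:ℝ) < 2 ^ (2 * m) := by positivity
  have h1 := hm.floor_eq ht0.le ht1
  have h2 := hn.floor_eq hu0.le hu1
  rw [← hx] at h1
  rw [← hx'] at h2
  refine ⟨mul_left_cancel₀ hp.ne' (h1.symm.trans h2), ?_⟩
  have h3 := hm.D_hump ht0.le ht1 1
  have h4 := hn.D_hump hu0.le hu1 1
  rw [← hx] at h3
  rw [← hx', h3] at h4
  have h5 := hs 1 le_rfl
  have h6 := hs' 1 le_rfl
  rw [← h4] at h6
  have h7 := mul_pos h5 h6
  rw [show s * D 1 t * (s' * D 1 t) = s * s' * (D 1 t * D 1 t) by ring] at h7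
  exact pos_of_mul_pos_left h7 (mul_self_nonneg _)

theorem FinalExcursion.eq_of_T_eq {s : ℤ} (hs : s = 1 ∨ s = -1) {x₀ x x' : ℝ}
    (h : FinalExcursion s x₀ x) (h' : FinalExcursion s x₀ x') (hT : T x = T x')
    (hnd : ∀ (n : ℕ) (k : ℤ), 2 ^ n * x ≠ k) (hnd' : ∀ (n : ℕ) (k : ℤ), 2 ^ n * x' ≠ k) :
    x = x' := by
  obtain ⟨m, t, hm, ht0, ht1, rfl, hst⟩ := h
  obtain ⟨n, u, hn, hu0, hu1, rfl, hsu⟩ := h'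
  obtain rfl := hm.order_unique hn
  replace hnd := hm.not_dyadic_of_hump hnd
  replace hnd' := hm.not_dyadic_of_hump hnd'
  have hTtu : T t = T u := by
    rw [hm.T_hump ht0.le ht1.le, hm.T_hump hu0.le hu1.le] at hT
    exact (div_left_inj' (by positivity)).1 (add_left_cancel hT)
  have inj : ∀ {a b : ℝ}, 0 ≤ a → a < 1 → 0 ≤ b → b < 1 → (∀ j, 1 ≤ j → 0 < D j a) →
      (∀ j, 1 ≤ j → 0 < D j b) → (∀ (n : ℕ) (k : ℤ), 2 ^ n * a ≠ k) →
      (∀ (n : ℕ) (k : ℤ), 2 ^ n * b ≠ k) → T a = T b → a = b := by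
    intro a b ha0 ha1 hb0 hb1 ha hb hna hnb hab
    rcases lt_trichotomy a b with h | h | h
    · exact absurd hab (T_lt_T_of_D_pos ha0 h hb1 ha hb hnb).ne
    · exact h
    · exact absurd hab (T_lt_T_of_D_pos hb0 h ha1 hb ha hna).ne'
  have hrefl : ∀ {a : ℝ}, (∀ (n : ℕ) (k : ℤ), 2 ^ n * a ≠ k) →
      ∀ (n : ℕ) (k : ℤ), 2 ^ n * (1 - a) ≠ k := fun ha n k hk => ha n (2 ^ n - k) (by
    push_cast
    linarith)
  have htu : t = u := by
    rcases hs with rfl | rfl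
    · exact inj ht0.le ht1 hu0.le hu1 (by simpa using hst) (by simpa using hsu) hnd hnd' hTtu
    · have := inj (a := 1 - t) (b := 1 - u) (by linarith) (by linarith) (by linarith)
        (by linarith) (fun j hj => by rw [D_one_sub fun n _ => hnd n]; linarith [hst j hj])
        (fun j hj => by rw [D_one_sub fun n _ => hnd' n]; linarith [hsu j hj])
        (hrefl hnd) (hrefl hnd') (by rw [T_one_sub, T_one_sub, hTtu])
      linarith
  rw [htu]

theorem exists_finalExcursion {y : ℝ} (hy : 0 < y) (hfin : (L y).Finite) {x₀ : ℝ} {m : ℕ}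
    (hm : BalancedOfOrder x₀ m) (hmem : y ∈ Icc (T x₀) (T x₀ + (1/2) * (1:ℝ) / 4 ^ m)) {s : ℤ}
    (hs : s = 1 ∨ s = -1) : ∃ x ∈ L y, FinalExcursion s x₀ x := by
  have h4 : (0:ℝ) < 4 ^ m := by positivity
  obtain ⟨t, ht0, ht1, hTt, hD⟩ := exists_T_eq_and_D_pos (v := (y - T x₀) * 4 ^ m)
    (mul_nonneg (by linarith [hmem.1]) h4.le) (by
      rw [← le_div_iff₀ h4]
      have := hmem.2
      rw [mul_one] at this
      linarith)
  have hL : ∀ u, 0 ≤ u → u ≤ 1 → T u = T t → x₀ + u / 2 ^ (2 * m) ∈ L y := fun u hu0 hu1 hTu => by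
    refine ⟨hm.mem_Icc_hump hu0 hu1, ?_⟩
    rw [hm.T_hump hu0 hu1, hTu, hTt, mul_div_cancel_right₀ _ h4.ne']
    ring
  have hnd := hm.not_dyadic_of_hump
    (not_dyadic_of_finite hy hfin (hL t ht0 (by linarith) rfl))
  have ht0' : 0 < t := ht0.lt_of_ne fun h => hnd 0 0 (by simp [← h])
  rcases hs with rfl | rfl
  · exact ⟨_, hL t ht0 (by linarith) rfl, m, t, hm, ht0', by linarith, rfl, by simpa using hD⟩
  · refine ⟨_, hL (1 - t) (by linarith) (by linarith) (T_one_sub t), m, 1 - t, hm, by linarith,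
      by linarith, rfl, fun j hj => ?_⟩
    rw [D_one_sub fun n _ => hnd n]
    linarith [hD j hj]

theorem exists_balanced_of_mem_L {y : ℝ} (hy : 0 < y) (hfin : (L y).Finite) {x : ℝ}
    (hx : x ∈ L y) : ∃ x₀, (∃ m : ℕ, BalancedOfOrder x₀ m ∧
      y ∈ Icc (T x₀) (T x₀ + (1/2) * (1:ℝ) / 4 ^ m)) ∧
      (FinalExcursion 1 x₀ x ∨ FinalExcursion (-1) x₀ x) := by
  have hnd := not_dyadic_of_finite hy hfin hx
  have hbdd := bddAbove_zeros_of_finite hy hfin hx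
  have hx1 : x < 1 := hx.1.2.lt_of_ne fun h => hnd 0 1 (by simp [h])
  have hmem := Nat.sSup_mem ⟨0, D_zero x⟩ hbdd
  obtain ⟨n, hn⟩ : ∃ n, n = sSup {n : ℕ | D n x = 0} := ⟨_, rfl⟩
  rw [← hn] at hmem
  have hDn : D n x = 0 := hmem
  have hlast : ∀ j, n < j → D j x ≠ 0 := fun j hj h => by
    have := le_csSup hbdd (show j ∈ {n : ℕ | D n x = 0} from h)
    omega
  obtain ⟨m, rfl⟩ : ∃ m, n = 2 * m := by
    have := D_emod_two n x
    exact ⟨n / 2, by omega⟩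
  have hp : (0:ℝ) < 2 ^ (2 * m) := by positivity
  obtain ⟨t, ht⟩ : ∃ t, t = Int.fract (2 ^ (2 * m) * x) := ⟨_, rfl⟩
  have ht0 : 0 < t := by
    refine (ht ▸ Int.fract_nonneg _ : 0 ≤ t).lt_of_ne fun h => hnd (2 * m) ⌊2 ^ (2 * m) * x⌋ ?_
    have := Int.fract_add_floor (2 ^ (2 * m) * x)
    rw [← ht, ← h, zero_add] at this
    exact this.symm
  have ht1 : t < 1 := ht ▸ Int.fract_lt_one _
  obtain ⟨x₀, hx₀⟩ : ∃ x₀ : ℝ, x₀ = ⌊2 ^ (2 * m) * x⌋ / 2 ^ (2 * m) := ⟨_, rfl⟩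
  have hxx₀ : x = x₀ + t / 2 ^ (2 * m) := by
    rw [hx₀, ht, ← add_div, Int.floor_add_fract, mul_div_cancel_left₀ _ hp.ne']
  have hbal : BalancedOfOrder x₀ m := by
    refine ⟨⟨?_, ?_⟩, ⟨_, hx₀⟩, ?_⟩
    · rw [hx₀]
      have : (0:ℝ) ≤ ⌊2 ^ (2 * m) * x⌋ := by
        exact_mod_cast Int.floor_nonneg.2 (mul_nonneg hp.le hx.1.1)
      positivity
    · have : 0 < t / 2 ^ (2 * m) := by positivity
      linarith
    · rw [← hDn]
      apply D_congr
      rw [hx₀, mul_div_cancel₀ _ hp.ne', Int.floor_intCast]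
  have hDt : ∀ j, D (2 * m + j) x = D j t := fun j => by
    rw [hxx₀]
    exact hbal.D_hump ht0.le ht1 j
  have hne : ∀ j, 1 ≤ j → D j t ≠ 0 := fun j hj => by
    rw [← hDt]
    exact hlast _ (by omega)
  have hTx := hbal.T_hump ht0.le ht1.le
  rw [← hxx₀, hx.2] at hTx
  have h4 : (0:ℝ) < 4 ^ m := by positivity
  have hlow : T x₀ ≤ y := by
    have := div_nonneg (T_nonneg t) h4.le
    linarith
  have hup : T t ≤ 1 / 2 → y ≤ T x₀ + (1/2) * (1:ℝ) / 4 ^ m := fun h => by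
    have := div_le_div_of_nonneg_right h h4.le
    rw [mul_one]
    linarith
  rcases D_succ_eq 0 t with h1 | h1 <;> rw [D_zero, zero_add] at h1
  · have hpos : ∀ j, 1 ≤ j → 0 < D j t := fun j hj => by
      by_contra h
      obtain ⟨i, hi, hi0⟩ := exists_D_eq_zero_of_pos hj (by rw [h1]; norm_num) (not_lt.1 h)
      exact hne i hi.le hi0
    exact ⟨x₀, ⟨m, hbal, hlow, hup (T_le_half_of_D_pos ht0.le ht1 hpos)⟩,
      Or.inl ⟨m, t, hbal, ht0, ht1, hxx₀, by simpa using hpos⟩⟩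
  · have hneg : ∀ j, 1 ≤ j → 0 < -D j t := fun j hj => by
      by_contra h
      obtain ⟨i, hi, hi0⟩ := exists_D_eq_zero_of_neg hj (by rw [h1]; norm_num)
        (by omega : 0 ≤ D j t)
      exact hne i hi.le hi0
    have hnt := hbal.not_dyadic_of_hump (t := t) (by rwa [← hxx₀])
    refine ⟨x₀, ⟨m, hbal, hlow, hup ?_⟩,
      Or.inr ⟨m, t, hbal, ht0, ht1, hxx₀, by simpa using hneg⟩⟩
    rw [← T_one_sub]
    refine T_le_half_of_D_pos (by linarith) (by linarith) fun j hj => ?_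
    rw [D_one_sub fun n _ => hnt n]
    exact hneg j hj

theorem ncard_L_of_pos {y : ℝ} (hy : 0 < y) (hfin : (L y).Finite) :
    (L y).ncard =
      2 * {x₀ : ℝ | ∃ m : ℕ, BalancedOfOrder x₀ m ∧
        y ∈ Icc (T x₀) (T x₀ + (1/2) * (1:ℝ) / 4 ^ m)}.ncard := by
  set S := {x₀ : ℝ | ∃ m : ℕ, BalancedOfOrder x₀ m ∧
    y ∈ Icc (T x₀) (T x₀ + (1/2) * (1:ℝ) / 4 ^ m)}
  have hex : ∀ s : ℤ, s = 1 ∨ s = -1 → ∃ f : ℝ → ℝ,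
      ∀ x₀ ∈ S, f x₀ ∈ L y ∧ FinalExcursion s x₀ (f x₀) := fun s hs => by
    have : ∀ x₀, ∃ x, x₀ ∈ S → x ∈ L y ∧ FinalExcursion s x₀ x := fun x₀ => by
      by_cases h : x₀ ∈ S
      · obtain ⟨m, hm, hmem⟩ := h
        obtain ⟨x, hx⟩ := exists_finalExcursion hy hfin hm hmem hs
        exact ⟨x, fun _ => hx⟩
      · exact ⟨0, fun h' => absurd h' h⟩
    choose f hf using this
    exact ⟨f, hf⟩
  obtain ⟨f, hf⟩ := hex 1 (Or.inl rfl)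
  obtain ⟨g, hg⟩ := hex (-1) (Or.inr rfl)
  have hL : L y = f '' S ∪ g '' S := by
    ext x
    refine ⟨fun hx => ?_, ?_⟩
    · obtain ⟨x₀, hx₀, h | h⟩ := exists_balanced_of_mem_L hy hfin hx
      · exact Or.inl ⟨x₀, hx₀, FinalExcursion.eq_of_T_eq (Or.inl rfl) (hf x₀ hx₀).2 h
          ((hf x₀ hx₀).1.2.trans hx.2.symm) (not_dyadic_of_finite hy hfin (hf x₀ hx₀).1)
          (not_dyadic_of_finite hy hfin hx)⟩
      · exact Or.inr ⟨x₀, hx₀, FinalExcursion.eq_of_T_eq (Or.inr rfl) (hg x₀ hx₀).2 h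
          ((hg x₀ hx₀).1.2.trans hx.2.symm) (not_dyadic_of_finite hy hfin (hg x₀ hx₀).1)
          (not_dyadic_of_finite hy hfin hx)⟩
    · rintro (⟨x₀, hx₀, rfl⟩ | ⟨x₀, hx₀, rfl⟩)
      · exact (hf x₀ hx₀).1
      · exact (hg x₀ hx₀).1
  have hdisj : Disjoint (f '' S) (g '' S) := by
    rw [Set.disjoint_left]
    rintro _ ⟨x₀, hx₀, rfl⟩ ⟨x₁, hx₁, h⟩
    have h1 := (hf x₀ hx₀).2
    rw [← h] at h1
    have := (h1.unique (hg x₁ hx₁).2).2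
    omega
  have hfi : InjOn f S := fun x₀ hx₀ x₁ hx₁ h => by
    have h1 := (hf x₀ hx₀).2
    rw [h] at h1
    exact (h1.unique (hf x₁ hx₁).2).1
  have hgi : InjOn g S := fun x₀ hx₀ x₁ hx₁ h => by
    have h1 := (hg x₀ hx₀).2
    rw [h] at h1
    exact (h1.unique (hg x₁ hx₁).2).1
  have hff : (f '' S).Finite := hfin.subset (hL ▸ subset_union_left)
  have hgf : (g '' S).Finite := hfin.subset (hL ▸ subset_union_right)
  rw [hL, ncard_union_eq hdisj hff hgf, hfi.ncard_image, hgi.ncard_image]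
  ring

theorem eq_zero_or_one_of_T_le_zero {x : ℝ} (hx : x ∈ Icc (0:ℝ) 1) (h : T x ≤ 0) :
    x = 0 ∨ x = 1 := by
  by_contra! hne
  exact absurd (T_pos (hx.1.lt_of_ne hne.1.symm) (hx.2.lt_of_ne hne.2)) (not_lt.2 h)

theorem T_one : T 1 = 0 := by simpa using T_int 1

theorem L_zero : L 0 = {0, 1} := by
  ext x
  refine ⟨fun hx => eq_zero_or_one_of_T_le_zero hx.1 hx.2.le, ?_⟩
  rintro (rfl | rfl)
  · exact ⟨by norm_num, T_zero⟩
  · exact ⟨by norm_num, T_one⟩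

theorem setOf_balanced_zero :
    {x₀ : ℝ | ∃ m : ℕ, BalancedOfOrder x₀ m ∧
      (0:ℝ) ∈ Icc (T x₀) (T x₀ + (1/2) * (1:ℝ) / 4 ^ m)} = {0} := by
  ext x
  constructor
  · rintro ⟨m, ⟨hx, -⟩, hT, -⟩
    rcases eq_zero_or_one_of_T_le_zero ⟨hx.1, hx.2.le⟩ hT with h | h
    · exact h
    · exact absurd h hx.2.ne
  · rintro rfl
    refine ⟨0, ⟨by norm_num, ⟨0, by simp⟩, D_zero 0⟩, ?_⟩
    rw [T_zero]
    norm_num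

theorem stmt6 (y : ℝ) (hy : y ∈ Set.Icc (0:ℝ) (2/3)) (hfin : (L y).Finite) :
    (L y).ncard =
      2 * {x₀ : ℝ | ∃ m : ℕ, BalancedOfOrder x₀ m ∧
        y ∈ Set.Icc (T x₀) (T x₀ + (1/2) * (1:ℝ) / 4 ^ m)}.ncard := by
  rcases hy.1.eq_or_lt with rfl | hpos
  · rw [L_zero, setOf_balanced_zero, ncard_singleton, ncard_pair zero_ne_one]
  · exact ncard_L_of_pos hpos hfin
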